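/- Let p be a positive integer and suppose k > sqrt(p²(p²−1)/6 · ⌊(p+2)/2⌋). Then there is no real polynomial q of degree at most p, not identically zero, satisfying: q(0) = 0, q(j) ≥ 0 for all integers 1 ≤ j ≤ k, and q'(j) ≤ 0 for all integers 1 ≤ j ≤ k, with q nonnegative on [0,k] and of degree exactly p. -/

import Mathlib

open Polynomial

/-- To the right of all its roots, a product of monic real linear factors is positive, has
nonnegative first and second derivatives, and is log-concave. -/
lemma prod_X_sub_C_eval_derivatives {ι : Type*} (s : Finset ι) (v : ι → ℝ) {x : ℝ}
    (h : ∀ j ∈ s, v j < x) :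
    0 < (∏ j ∈ s, (X - C (v j))).eval x ∧
    0 ≤ (derivative (∏ j ∈ s, (X - C (v j)))).eval x ∧
    0 ≤ (derivative (derivative (∏ j ∈ s, (X - C (v j))))).eval x ∧
    (∏ j ∈ s, (X - C (v j))).eval x *
        (derivative (derivative (∏ j ∈ s, (X - C (v j))))).eval x ≤
      (derivative (∏ j ∈ s, (X - C (v j)))).eval x ^ 2 := by
  classical
  induction s using Finset.induction_on with
  | empty => simp
  | insert i s hi ih =>
    obtain ⟨h0, h1, h2, h3⟩ := ih fun j hj => h j (Finset.mem_insert_of_mem hj)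
    have hd : 0 < x - v i := sub_pos.2 (h i (Finset.mem_insert_self i s))
    rw [Finset.prod_insert hi]
    generalize ∏ j ∈ s, (X - C (v j)) = g at *
    simp only [derivative_mul, derivative_sub, derivative_X, derivative_C, sub_zero, one_mul,
      derivative_add, eval_add, eval_mul, eval_sub, eval_X, eval_C]
    refine ⟨by positivity, by positivity, by positivity, ?_⟩
    nlinarith [mul_nonneg (sq_nonneg (x - v i)) (sub_nonneg.2 h3), sq_nonneg (eval x g)]

/-- If `(X - 1) * G` is convex at `x ≤ 1`, where `x` lies to the right of all the roots of the
real-rooted polynomial `G`, then it stays so when a root of `G` is removed. -/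
lemma convex_at_of_erase_root {ι : Type*} [DecidableEq ι] (s : Finset ι) (v : ι → ℝ) {x : ℝ}
    (hx : x ≤ 1) (h : ∀ j ∈ s, v j < x) {i : ι} (hi : i ∈ s)
    (hG : 0 ≤ (derivative (derivative ((X - 1) * ∏ j ∈ s, (X - C (v j))))).eval x) :
    0 ≤ (derivative (derivative ((X - 1) * ∏ j ∈ s.erase i, (X - C (v j))))).eval x := by
  obtain ⟨h0, h1, h2, h3⟩ := prod_X_sub_C_eval_derivatives (s.erase i) v
    fun j hj => h j (Finset.mem_of_mem_erase hj)
  have hd : 0 < x - v i := sub_pos.2 (h i hi)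
  rw [← Finset.mul_prod_erase s _ hi] at hG
  generalize ∏ j ∈ s.erase i, (X - C (v j)) = g at *
  simp only [derivative_mul, derivative_sub, derivative_X, derivative_C, derivative_one, sub_zero,
    one_mul, derivative_add, eval_add, eval_mul, eval_sub, eval_X, eval_C, eval_one] at hG ⊢
  generalize eval x g = a at *
  generalize eval x (derivative g) = b at *
  generalize eval x (derivative (derivative g)) = c at *
  generalize x - v i = d at *
  by_contra! hneg
  have hc : 2 * b < (1 - x) * c := by linarith
  have key : 0 < b * ((1 - x) * b - 2 * a) := by
    nlinarith [mul_pos h0 (sub_pos.2 hc), mul_nonneg (sub_nonneg.2 hx) (sub_nonneg.2 h3)]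
  have hb : 2 * a < (1 - x) * b := by
    by_contra! hle
    nlinarith [mul_nonneg h1 (sub_nonneg.2 hle)]
  nlinarith [mul_pos hd (sub_pos.2 hc)]

open Polynomial.Chebyshev hiding C C_neg in
/-- Chebyshev polynomials of the second kind in factored form, over the interior extremal points of
the corresponding Chebyshev polynomial of the first kind. -/
lemma U_real_eq_prod_node {n : ℕ} (hn : 1 ≤ n) :
    U ℝ ((n : ℤ) - 1) =
      C (2 ^ (n - 1)) * ∏ j ∈ Finset.Ioo 0 n, (X - C (node n j)) := by
  obtain ⟨m, rfl⟩ := Nat.exists_eq_add_of_le' hn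
  have h1 : ((m + 1 : ℕ) : ℤ) - 1 = (m : ℤ) := by push_cast; ring
  rw [h1]
  have hroots := roots_U_real m
  have hnodup := roots_U_real_nodup m
  have hval : (U ℝ m).roots =
      Multiset.map (fun k : ℕ ↦ Real.cos ((k + 1) * Real.pi / (m + 1))) (.range m) := by
    rw [hroots, Finset.image_val]
    exact Multiset.dedup_eq_self.2 hnodup
  have hcard : Multiset.card (U ℝ m).roots = (U ℝ m).natDegree := by
    rw [hval]; simp
  rw [← C_leadingCoeff_mul_prod_multiset_X_sub_C hcard, hval]
  congr 1
  · simp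
  · rw [Multiset.map_map]
    have : Finset.Ioo 0 (m + 1) = (Finset.range m).image (· + 1) := by
      ext j; simp only [Finset.mem_Ioo, Finset.mem_image, Finset.mem_range]
      constructor
      · rintro ⟨h, h'⟩; exact ⟨j - 1, by omega, by omega⟩
      · rintro ⟨a, h, rfl⟩; omega
    rw [this, Finset.prod_image (by simp)]
    simp [Finset.prod, node]

open Polynomial.Chebyshev hiding C C_neg in
lemma convex_at_X_sub_one_mul_prod_node {n : ℕ} (hn : 1 ≤ n) {x : ℝ} (hx : x ≤ 1)
    (hx1 : node n 1 < x) :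
    0 ≤ (derivative (derivative
      ((X - 1) * ∏ j ∈ Finset.Ioo 0 n, (X - C (node n j))))).eval x := by
  have hlt : ∀ j ∈ Finset.Ioo 0 n, node n j < x := fun j hj => by
    obtain ⟨hj0, hjn⟩ := Finset.mem_Ioo.1 hj
    refine lt_of_le_of_lt ?_ hx1
    rcases (Nat.succ_le_of_lt hj0).eq_or_lt with h | h
    · exact (congrArg (node n) h.symm).le
    · exact (node_lt hjn.le h).le
  obtain ⟨h0, h1, h2, -⟩ := prod_X_sub_C_eval_derivatives _ (node n) hlt
  have hode := one_sub_X_sq_mul_iterate_derivative_T_eval (R := ℝ) n 1 x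
  have hT : derivative (T ℝ n) =
      C ((n : ℝ) * 2 ^ (n - 1)) * ∏ j ∈ Finset.Ioo 0 n, (X - C (node n j)) := by
    rw [T_derivative_eq_U, U_real_eq_prod_node hn, ← mul_assoc, map_mul, map_pow, map_natCast,
      Int.cast_natCast]
  simp only [Function.iterate_succ_apply, Function.iterate_zero_apply, hT] at hode
  generalize ∏ j ∈ Finset.Ioo 0 n, (X - C (node n j)) = G at *
  simp only [derivative_mul, derivative_sub, derivative_X, derivative_C, derivative_one, sub_zero,
    one_mul, derivative_add, eval_add, eval_mul, eval_sub, eval_X, eval_C, eval_one, zero_mul,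
    zero_add, Int.cast_natCast, Nat.cast_one] at hode ⊢
  have hn' : (1 : ℝ) ≤ n := by exact_mod_cast hn
  have hx' : 0 < 1 + x := by linarith [(node_mem_Icc (n := n) (i := 1)).1]
  have hc : (0 : ℝ) < n * 2 ^ (n - 1) := by positivity
  generalize (n : ℝ) * 2 ^ (n - 1) = c at *
  generalize eval x G = a at *
  generalize eval x (derivative G) = b at *
  generalize eval x (derivative (derivative G)) = d at *
  have hode' : (1 - x ^ 2) * d = 3 * x * b - (n ^ 2 - 1) * a := by
    apply mul_left_cancel₀ hc.ne'
    linear_combination hode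
  have hn2 : (0 : ℝ) ≤ n ^ 2 - 1 := by nlinarith
  refine (mul_nonneg_iff_of_pos_left hx').1 ?_
  have : (1 + x) * (b + (b + (x - 1) * d)) = (2 - x) * b + (n ^ 2 - 1) * a := by
    linear_combination -hode'
  rw [this]
  have : 0 ≤ 2 - x := by linarith
  positivity

open Polynomial.Chebyshev hiding C C_neg in
lemma convex_at_prod_erase_node {n : ℕ} (hn : 1 ≤ n) {x : ℝ} (hx : x ≤ 1)
    (hx1 : node n 1 < x) {i : ℕ} (hi : i ≤ n) :
    0 ≤ (derivative (derivative
      (∏ j ∈ (Finset.range (n + 1)).erase i, (X - C (node n j))))).eval x := by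
  have hlt : ∀ j ∈ Finset.Ioc 0 n, node n j < x := fun j hj => by
    obtain ⟨hj0, hjn⟩ := Finset.mem_Ioc.1 hj
    refine lt_of_le_of_lt ?_ hx1
    rcases (Nat.succ_le_of_lt hj0).eq_or_lt with h | h
    · exact (congrArg (node n) h.symm).le
    · exact (node_lt hjn h).le
  have hlt' : ∀ j ∈ Finset.Ioo 0 n, node n j < x := fun j hj =>
    hlt j (Finset.Ioo_subset_Ioc_self hj)
  have hG := convex_at_X_sub_one_mul_prod_node hn hx hx1
  rcases Nat.eq_zero_or_pos i with rfl | hi0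
  · have : (Finset.range (n + 1)).erase 0 = Finset.Ioc 0 n := by ext; grind
    rw [this]
    exact (prod_X_sub_C_eval_derivatives _ (node n) hlt).2.2.1
  rcases hi.eq_or_lt with rfl | hin
  · have : (Finset.range (i + 1)).erase i = insert 0 (Finset.Ioo 0 i) := by
      ext; grind
    rw [this, Finset.prod_insert (by simp), node_eq_one, C_1]
    exact hG
  · have hmem : i ∈ Finset.Ioo 0 n := Finset.mem_Ioo.2 ⟨hi0, hin⟩
    have hH := convex_at_of_erase_root _ (node n) hx hlt' hmem hG
    have : (Finset.range (n + 1)).erase i = insert 0 (insert n ((Finset.Ioo 0 n).erase i)) := by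
      ext; grind
    rw [this, Finset.prod_insert (by simp; omega), Finset.prod_insert (by simp), node_eq_one, C_1,
      node_eq_neg_one (by omega), C_neg, C_1]
    rw [← Finset.mul_prod_erase _ _ hmem] at hG
    have hi1 : 0 ≤ node n i + 1 := by linarith [(node_mem_Icc (n := n) (i := i)).1]
    generalize ∏ j ∈ (Finset.Ioo 0 n).erase i, (X - C (node n j)) = g at *
    have hsplit : (X - 1) * ((X - -1) * g) =
        (X - 1) * ((X - C (node n i)) * g) + C (node n i + 1) * ((X - 1) * g) := by
      rw [C_add, C_1]; ring
    rw [hsplit, derivative_add, derivative_add, derivative_C_mul, derivative_C_mul, eval_add,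
      eval_C_mul]
    exact add_nonneg hG (mul_nonneg hi1 hH)

open Polynomial.Chebyshev hiding C C_neg in
/-- The Markov bound for the second derivative, to the right of the largest critical point of the
Chebyshev polynomial. -/
lemma eval_derivative_derivative_le_of_node_one_lt {n : ℕ} (hn : 1 ≤ n) {P : ℝ[X]}
    (hP : P.degree ≤ n) (hPb : ∀ x ∈ Set.Icc (-1 : ℝ) 1, |P.eval x| ≤ 1) {x : ℝ} (hx : x ≤ 1)
    (hx1 : node n 1 < x) :
    (derivative (derivative P)).eval x ≤ (derivative (derivative (T ℝ n))).eval 1 := by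
  set c : ℕ → ℝ := fun i =>
    (derivative (derivative (Lagrange.basis (Finset.range (n + 1)) (node n) i))).eval x
  have hrep : ∀ Q : ℝ[X], Q.degree ≤ n → (derivative (derivative Q)).eval x = sumNodes n c Q := by
    intro Q hQ
    have h1 : Q.degree < (Finset.range (n + 1)).card := by
      rw [Finset.card_range]; grw [hQ]; norm_cast; simp
    conv_lhs => rw [Lagrange.eq_interpolate (strictAntiOn_node n).injOn h1]
    rw [Lagrange.interpolate_apply]
    simp only [derivative_sum, derivative_C_mul, eval_finsetSum, eval_C_mul, sumNodes]
    rw [Nat.range_succ_eq_Iic]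
    simp [c, Nat.range_succ_eq_Iic]
  have hc : ∀ i ≤ n, 0 ≤ (-1) ^ i * c i := by
    intro i hi
    have hb : Lagrange.basis (Finset.range (n + 1)) (node n) i =
        C ((∏ j ∈ (Finset.range (n + 1)).erase i, (node n i - node n j))⁻¹) *
          ∏ j ∈ (Finset.range (n + 1)).erase i, (X - C (node n j)) := by
      simp only [Lagrange.basis, Lagrange.basisDivisor, Finset.prod_mul_distrib]
      rw [← map_prod, Finset.prod_inv_distrib]
    simp only [c, hb, derivative_C_mul, eval_C_mul]
    rw [← mul_assoc]
    refine mul_nonneg ?_ (convex_at_prod_erase_node hn hx hx1 hi)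
    have := (inv_pos.2 (zero_lt_prod_node_sub_node hi)).le
    rwa [mul_inv, ← inv_pow, inv_neg_one] at this
  rw [hrep P hP]
  refine (sumNodes_le_sumNodes_T hc hPb).trans ?_
  rw [← hrep _ (degree_T ℝ n).le]
  refine (le_abs_self _).trans ?_
  refine abs_iterate_derivative_T_real_le n 2 (abs_le.2 ⟨?_, hx⟩)
  linarith [(node_mem_Icc (n := n) (i := 1)).1]

lemma hasSum_one_div_sq_mul_neg_one_pow_mul_cos {t : ℝ} (ht : t ∈ Set.Icc (0 : ℝ) 1) :
    HasSum (fun j : ℕ => 1 / (j : ℝ) ^ 2 * ((-1) ^ j * Real.cos (j * Real.pi * t)))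
      (Real.pi ^ 2 * (t ^ 2 / 4 - 1 / 12)) := by
  have h := hasSum_one_div_nat_pow_mul_cos one_ne_zero (x := 1 / 2 + t / 2)
    ⟨by linarith [ht.1], by linarith [ht.2]⟩
  convert! h using 1
  · ext j
    rw [mul_one, show 2 * Real.pi * j * (1 / 2 + t / 2) = j * Real.pi * t + j * Real.pi by ring,
      Real.cos_add_nat_mul_pi]
  · simp [Polynomial.bernoulli, Finset.sum_range_succ, _root_.bernoulli_one, Nat.factorial]
    ring

open Polynomial.Chebyshev hiding C C_neg in
/-- The operator `P ↦ (1 - x ^ 2) P'' - x P'` at `x = cos θ`, as an absolutely convergent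
combination of values of `P` at the points `cos (θ ± j π / n)`. -/
lemma hasSum_eval_cos_add {n : ℕ} (hn : n ≠ 0) {P : ℝ[X]} (hP : P.natDegree ≤ n) (θ : ℝ) :
    HasSum (fun j : ℕ => 1 / (j : ℝ) ^ 2 * ((-1) ^ j *
        ((P.eval (Real.cos (θ + j * Real.pi / n)) + P.eval (Real.cos (θ - j * Real.pi / n))) / 2)))
      (Real.pi ^ 2 / (4 * n ^ 2) * (Real.cos θ * (derivative P).eval (Real.cos θ)
        - (1 - Real.cos θ ^ 2) * (derivative (derivative P)).eval (Real.cos θ)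
        - n ^ 2 / 3 * P.eval (Real.cos θ))) := by
  have hn' : (0 : ℝ) < n := by exact_mod_cast Nat.pos_of_ne_zero hn
  have hmem : P ∈ Submodule.span ℝ (chebyshevTsequence ℝ '' Set.Iio (n + 1)) := by
    rw [Sequence.span_degreeLT (chebyshevTsequence ℝ) (by simp), mem_degreeLT]
    exact (degree_le_of_natDegree_le hP).trans_lt (by exact_mod_cast n.lt_succ_self)
  clear hP
  induction hmem using Submodule.span_induction with
  | zero => simp
  | add Q R _ _ hQ hR =>
    convert! hQ.add hR using 1
    · ext j; simp only [eval_add]; ring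
    · simp only [eval_add, derivative_add]; ring
  | smul c Q _ hQ =>
    convert! hQ.mul_left c using 1
    · ext j; simp only [eval_smul, smul_eq_mul]; ring
    · simp only [eval_smul, derivative_smul, smul_eq_mul]; ring
  | mem Q hQ =>
    obtain ⟨m, hm, rfl⟩ := hQ
    change HasSum (fun j : ℕ => 1 / (j : ℝ) ^ 2 * ((-1) ^ j *
        (((T ℝ m).eval (Real.cos (θ + j * Real.pi / n))
          + (T ℝ m).eval (Real.cos (θ - j * Real.pi / n))) / 2)))
      (Real.pi ^ 2 / (4 * n ^ 2) * (Real.cos θ * (derivative (T ℝ m)).eval (Real.cos θ)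
        - (1 - Real.cos θ ^ 2) * (derivative (derivative (T ℝ m))).eval (Real.cos θ)
        - n ^ 2 / 3 * (T ℝ m).eval (Real.cos θ)))
    have hmn : (m : ℝ) ≤ n := by exact_mod_cast Nat.lt_succ_iff.1 hm
    have hode := one_sub_X_sq_mul_iterate_derivative_T_eval (R := ℝ) m 0 (Real.cos θ)
    simp only [zero_add, Function.iterate_succ_apply, Function.iterate_zero_apply, T_real_cos,
      CharP.cast_eq_zero, Int.cast_natCast] at hode
    convert! (hasSum_one_div_sq_mul_neg_one_pow_mul_cos (t := m / n)
      ⟨by positivity, (div_le_one hn').2 hmn⟩).mul_left (Real.cos (m * θ)) using 1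
    · ext j
      simp only [T_real_cos, Int.cast_natCast]
      rw [show m * (θ + j * Real.pi / n) = m * θ + j * Real.pi * (m / n) by ring,
        show m * (θ - j * Real.pi / n) = m * θ - j * Real.pi * (m / n) by ring,
        Real.cos_add, Real.cos_sub]
      ring
    · rw [hode, T_real_cos, Int.cast_natCast]
      field_simp
      ring

/-- Bernstein's inequality for the second derivative of `θ ↦ P (cos θ)`. -/
lemma abs_second_derivative_eval_cos_le {n : ℕ} (hn : n ≠ 0) {P : ℝ[X]} (hP : P.natDegree ≤ n)
    (hPb : ∀ x ∈ Set.Icc (-1 : ℝ) 1, |P.eval x| ≤ 1) (θ : ℝ) :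
    |(1 - Real.cos θ ^ 2) * (derivative (derivative P)).eval (Real.cos θ)
      - Real.cos θ * (derivative P).eval (Real.cos θ)| ≤ (n : ℝ) ^ 2 := by
  have hn' : (0 : ℝ) < n := by exact_mod_cast Nat.pos_of_ne_zero hn
  have hb : ∀ φ, |P.eval (Real.cos φ)| ≤ 1 := fun φ => hPb _ (Real.cos_mem_Icc φ)
  have h := (hasSum_eval_cos_add hn hP θ).norm_le_of_bounded hasSum_zeta_two fun j => by
    rw [Real.norm_eq_abs, abs_mul, abs_mul, abs_pow, abs_neg, abs_one, one_pow, one_mul,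
      abs_of_nonneg (by positivity : (0 : ℝ) ≤ 1 / (j : ℝ) ^ 2)]
    refine mul_le_of_le_one_right (by positivity) ?_
    rw [abs_le]
    constructor <;> linarith [abs_le.1 (hb (θ + j * Real.pi / n)),
      abs_le.1 (hb (θ - j * Real.pi / n))]
  rw [Real.norm_eq_abs, abs_mul, abs_of_pos (by positivity),
    show Real.pi ^ 2 / 6 = Real.pi ^ 2 / (4 * n ^ 2) * (2 / 3 * n ^ 2) by field_simp; norm_num] at h
  have h2 := abs_le.1 (le_of_mul_le_mul_left h (by positivity))
  have h3 := abs_le.1 (hb θ)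
  have h4 : (0 : ℝ) < n ^ 2 := by positivity
  rw [abs_le]
  constructor <;> nlinarith

lemma abs_cos_mul_eval_derivative_cos_le {n : ℕ} (hn : n ≠ 0) {P : ℝ[X]} (hP : P.natDegree ≤ n)
    (hPb : ∀ x ∈ Set.Icc (-1 : ℝ) 1, |P.eval x| ≤ 1) {θ : ℝ} (h0 : 0 < θ)
    (hθ : θ ≤ Real.pi / 2) :
    |Real.cos θ * (derivative P).eval (Real.cos θ)| ≤ (n : ℝ) ^ 2 := by
  have hderiv : ∀ φ : ℝ, HasDerivAt (fun φ => -Real.sin φ * (derivative P).eval (Real.cos φ))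
      ((1 - Real.cos φ ^ 2) * (derivative (derivative P)).eval (Real.cos φ)
        - Real.cos φ * (derivative P).eval (Real.cos φ)) φ := fun φ => by
    convert! (Real.hasDerivAt_sin φ).neg.mul
      (((derivative P).hasDerivAt (Real.cos φ)).comp φ (Real.hasDerivAt_cos φ)) using 1
    rw [← Real.sin_sq, Pi.neg_apply, Function.comp_apply]
    ring
  have hmv := convex_univ.norm_image_sub_le_of_norm_hasDerivWithin_le (C := (n : ℝ) ^ 2)
    (fun φ _ => (hderiv φ).hasDerivWithinAt) (fun φ _ => abs_second_derivative_eval_cos_le hn hP hPb φ)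
    (Set.mem_univ 0) (Set.mem_univ θ)
  have hs : 0 < Real.sin θ := Real.sin_pos_of_pos_of_lt_pi h0 (by linarith [Real.pi_pos])
  have hc : 0 ≤ Real.cos θ := Real.cos_nonneg_of_mem_Icc ⟨by linarith, hθ⟩
  have htan : θ * Real.cos θ ≤ Real.sin θ := by
    rcases hc.eq_or_lt with h | h
    · rw [← h, mul_zero]; exact hs.le
    · have hlt : θ < Real.pi / 2 := hθ.lt_of_ne fun h' => by
        rw [h', Real.cos_pi_div_two] at h; exact h.false
      have := Real.le_tan h0.le hlt
      rwa [Real.tan_eq_sin_div_cos, le_div_iff₀ h] at this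
  simp only [Real.sin_zero, neg_zero, zero_mul, sub_zero, Real.norm_eq_abs, abs_of_pos h0, abs_mul,
    abs_neg, abs_of_pos hs] at hmv
  rw [abs_mul, abs_of_nonneg hc]
  refine le_of_mul_le_mul_left ?_ hs
  nlinarith [mul_le_mul_of_nonneg_right hmv hc, mul_le_mul_of_nonneg_left htan (sq_nonneg (n : ℝ))]

lemma le_sin_pi_div {n : ℕ} (hn : 3 ≤ n) : 3 / (n : ℝ) * (√3 / 2) ≤ Real.sin (Real.pi / n) := by
  have hn' : (3 : ℝ) ≤ n := by exact_mod_cast hn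
  have h := strictConcaveOn_sin_Icc.concaveOn.2 ⟨le_refl (0 : ℝ), Real.pi_pos.le⟩
    (y := Real.pi / 3) ⟨by positivity, by linarith [Real.pi_pos]⟩
    (by rw [sub_nonneg, div_le_one (by positivity)]; exact hn' : (0 : ℝ) ≤ 1 - 3 / n)
    (by positivity : (0 : ℝ) ≤ 3 / n) (by ring)
  rw [Real.sin_zero, Real.sin_pi_div_three] at h
  simp only [smul_eq_mul, mul_zero, zero_add] at h
  rwa [show 3 / (n : ℝ) * (Real.pi / 3) = Real.pi / n by field_simp] at h

/-- The Markov bound for the second derivative on `[0, cos (π / n)]`, by Bernstein's inequality. -/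
lemma eval_derivative_derivative_le_of_le_node_one {n : ℕ} (hn : 3 ≤ n) {P : ℝ[X]}
    (hP : P.natDegree ≤ n) (hPb : ∀ x ∈ Set.Icc (-1 : ℝ) 1, |P.eval x| ≤ 1) {x : ℝ} (hx : 0 ≤ x)
    (hx1 : x ≤ Polynomial.Chebyshev.node n 1) :
    (derivative (derivative P)).eval x ≤ (n : ℝ) ^ 2 * (n ^ 2 - 1) / 3 := by
  have hn' : (3 : ℝ) ≤ n := by exact_mod_cast hn
  have hn0 : n ≠ 0 := by omega
  have hpi := Real.pi_pos
  have hnode : Polynomial.Chebyshev.node n 1 = Real.cos (Real.pi / n) := by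
    simp [Polynomial.Chebyshev.node]
  rw [hnode] at hx1
  obtain ⟨θ, hθ1, hθ2, rfl⟩ : ∃ θ, Real.pi / n ≤ θ ∧ θ ≤ Real.pi / 2 ∧ Real.cos θ = x := by
    refine ⟨Real.arccos x, ?_, Real.arccos_le_pi_div_two.2 hx,
      Real.cos_arccos (by linarith) (hx1.trans (Real.cos_le_one _))⟩
    rw [← Real.arccos_cos (x := Real.pi / n) (by positivity)
      (div_le_self hpi.le (by linarith))]
    exact Real.arccos_le_arccos hx1
  have h1 := (abs_le.1 (abs_second_derivative_eval_cos_le hn0 hP hPb θ)).2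
  have hpos : 0 < Real.pi / n := by positivity
  have h2 := (abs_le.1 (abs_cos_mul_eval_derivative_cos_le hn0 hP hPb (hpos.trans_le hθ1) hθ2)).2
  have hsin : 3 / (n : ℝ) * (√3 / 2) ≤ Real.sin θ := (le_sin_pi_div hn).trans
    (Real.sin_le_sin_of_le_of_le_pi_div_two (by linarith) hθ2 hθ1)
  have hsq := pow_le_pow_left₀ (by positivity) hsin 2
  rw [Real.sin_sq, mul_pow, div_pow, div_pow, Real.sq_sqrt (by norm_num)] at hsq
  rcases le_or_gt ((derivative (derivative P)).eval (Real.cos θ)) 0 with h | h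
  · exact h.trans (by have : (0 : ℝ) ≤ n ^ 2 - 1 := by nlinarith
                      positivity)
  · have h3 : 27 / (4 * (n : ℝ) ^ 2) * (derivative (derivative P)).eval (Real.cos θ)
        ≤ 2 * n ^ 2 := by
      have := mul_le_mul_of_nonneg_right hsq h.le
      rw [show (3 : ℝ) ^ 2 / n ^ 2 * (3 / 2 ^ 2) = 27 / (4 * n ^ 2) by field_simp; norm_num] at this
      linarith
    rw [div_mul_eq_mul_div, div_le_iff₀ (by positivity)] at h3
    nlinarith [mul_nonneg (sq_nonneg (n : ℝ)) (by nlinarith : (0 : ℝ) ≤ n ^ 2 - 9)]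

open Polynomial.Chebyshev hiding C C_neg in
lemma eval_one_derivative_derivative_T (n : ℕ) :
    (derivative (derivative (T ℝ n))).eval 1 = (n : ℝ) ^ 2 * (n ^ 2 - 1) / 3 := by
  have h := iterate_derivative_T_eval_one_eq_div (𝔽 := ℝ) n 2
  simp only [Function.iterate_succ_apply, Function.iterate_zero_apply] at h
  rw [h]
  norm_num [Finset.prod_range_succ]

/-- The Markov brothers' inequality for the second derivative. -/
theorem eval_derivative_derivative_le_of_abs_le_one {n : ℕ} (hn : 1 ≤ n) {P : ℝ[X]}
    (hP : P.natDegree ≤ n) (hPb : ∀ x ∈ Set.Icc (-1 : ℝ) 1, |P.eval x| ≤ 1) {x : ℝ}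
    (hx : x ∈ Set.Icc (-1 : ℝ) 1) :
    (derivative (derivative P)).eval x ≤ (n : ℝ) ^ 2 * (n ^ 2 - 1) / 3 := by
  wlog hx0 : 0 ≤ x generalizing P x
  · have h := this (P := P.comp (-X)) (x := -x) (by simpa [natDegree_comp] using hP)
      (fun y hy => by
        rw [eval_comp, eval_neg, eval_X]
        exact hPb _ ⟨by linarith [hy.2], by linarith [hy.1]⟩)
      ⟨by linarith [hx.2], by linarith [hx.1]⟩ (by linarith)
    simpa [derivative_comp] using h
  have hdeg : P.degree ≤ n := degree_le_of_natDegree_le hP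
  rcases lt_or_ge (Polynomial.Chebyshev.node n 1) x with h | h
  · rw [← eval_one_derivative_derivative_T]
    exact eval_derivative_derivative_le_of_node_one_lt hn hdeg hPb hx.2 h
  rcases Nat.lt_or_ge n 3 with h3 | h3
  · have hconst : (derivative (derivative P)).natDegree = 0 := by
      have h1 := natDegree_derivative_le P
      have h2 := natDegree_derivative_le (derivative P)
      omega
    have h1 : (derivative (derivative P)).eval x = (derivative (derivative P)).eval 1 := by
      rw [eq_C_of_natDegree_eq_zero hconst, eval_C, eval_C]
    rw [h1, ← eval_one_derivative_derivative_T]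
    refine eval_derivative_derivative_le_of_node_one_lt hn hdeg hPb le_rfl ?_
    rw [← Polynomial.Chebyshev.node_eq_one (n := n)]
    exact Polynomial.Chebyshev.node_lt hn Nat.zero_lt_one
  · exact eval_derivative_derivative_le_of_le_node_one h3 hP hPb hx0 h

/-- The Markov brothers' inequality for the second derivative of a polynomial with values in
`[0, M]` on the interval `[0, K]`. -/
lemma abs_eval_derivative_derivative_le_of_mem_Icc {n : ℕ} (hn : 1 ≤ n) {q : ℝ[X]}
    (hq : q.natDegree ≤ n) {K M : ℝ} (hK : 0 < K) (hM : 0 < M)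
    (hqb : ∀ x ∈ Set.Icc 0 K, q.eval x ∈ Set.Icc 0 M) {x : ℝ} (hx : x ∈ Set.Icc 0 K) :
    |(derivative (derivative q)).eval x| ≤ 2 * M / K ^ 2 * ((n : ℝ) ^ 2 * (n ^ 2 - 1) / 3) := by
  set P : ℝ[X] := C (2 / M) * q.comp (C (K / 2) * (X + 1)) - 1 with hPdef
  have heval : ∀ y, P.eval y = 2 / M * q.eval (K / 2 * (y + 1)) - 1 := fun y => by
    simp [hPdef, eval_comp]
  have hPdeg : P.natDegree ≤ n := by
    refine (natDegree_sub_le _ _).trans (max_le ?_ (by simp))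
    refine (natDegree_C_mul_le _ _).trans (natDegree_comp_le.trans ?_)
    have : (C (K / 2) * (X + 1)).natDegree ≤ 1 := by
      refine (natDegree_C_mul_le _ _).trans ?_
      rw [← C_1, natDegree_X_add_C]
    calc _ ≤ q.natDegree * 1 := Nat.mul_le_mul_left _ this
      _ ≤ n := by omega
  have hPb : ∀ y ∈ Set.Icc (-1 : ℝ) 1, |P.eval y| ≤ 1 := fun y hy => by
    have h := hqb (K / 2 * (y + 1))
      ⟨mul_nonneg (by positivity) (by linarith [hy.1]), by nlinarith [hy.2]⟩
    have h0 : 0 ≤ 2 / M * q.eval (K / 2 * (y + 1)) := mul_nonneg (by positivity) h.1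
    have h2 : 2 / M * q.eval (K / 2 * (y + 1)) ≤ 2 := by
      rw [div_mul_eq_mul_div, div_le_iff₀ hM]
      linarith [h.2]
    rw [heval, abs_le]
    constructor <;> linarith
  have hy : 2 * x / K - 1 ∈ Set.Icc (-1 : ℝ) 1 := by
    have h0 : 0 ≤ 2 * x / K := div_nonneg (by linarith [hx.1]) hK.le
    have h2 : 2 * x / K ≤ 2 := by rw [div_le_iff₀ hK]; linarith [hx.2]
    constructor <;> linarith
  have hder : (derivative (derivative P)).eval (2 * x / K - 1) =
      K ^ 2 / (2 * M) * (derivative (derivative q)).eval x := by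
    simp [hPdef, derivative_comp, eval_comp]
    field_simp
  have h1 := eval_derivative_derivative_le_of_abs_le_one hn hPdeg hPb hy
  have h2 := eval_derivative_derivative_le_of_abs_le_one hn (P := -P)
    ((natDegree_neg P).trans_le hPdeg) (fun y hy => by simpa using hPb y hy) hy
  rw [derivative_neg, derivative_neg, eval_neg] at h2
  have h3 : |K ^ 2 / (2 * M) * (derivative (derivative q)).eval x| ≤
      (n : ℝ) ^ 2 * (n ^ 2 - 1) / 3 := by
    rw [← hder, abs_le]
    constructor <;> linarith
  rw [abs_mul, abs_of_pos (by positivity)] at h3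
  calc |(derivative (derivative q)).eval x|
      = 2 * M / K ^ 2 * (K ^ 2 / (2 * M) * |(derivative (derivative q)).eval x|) := by
        field_simp
    _ ≤ _ := mul_le_mul_of_nonneg_left h3 (by positivity)

lemma eval_le_eval_of_derivative_nonpos {Q : ℝ[X]} {a b : ℝ} (hab : a ≤ b)
    (h : ∀ x ∈ Set.Ioo a b, (derivative Q).eval x ≤ 0) : Q.eval b ≤ Q.eval a := by
  refine antitoneOn_of_deriv_nonpos (convex_Icc a b) Q.continuousOn Q.differentiableOn ?_
    ⟨le_rfl, hab⟩ ⟨hab, le_rfl⟩ hab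
  intro x hx
  rw [Polynomial.deriv]
  exact h x (by rwa [interior_Icc] at hx)

lemma eval_le_add_of_derivative_left_nonpos {q : ℝ[X]} {a b B : ℝ} (hab : a ≤ b)
    (ha : (derivative q).eval a ≤ 0)
    (h : ∀ x ∈ Set.Icc a b, (derivative (derivative q)).eval x ≤ B) :
    q.eval b ≤ q.eval a + B / 2 * (b - a) ^ 2 := by
  have h1 : ∀ x ∈ Set.Icc a b, (derivative q).eval x ≤ B * (x - a) + (derivative q).eval a := by
    intro x hx
    have := eval_le_eval_of_derivative_nonpos (Q := derivative q - C B * X) hx.1 fun y hy => by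
      simpa using h y ⟨hy.1.le, hy.2.le.trans hx.2⟩
    simp only [eval_sub, eval_C_mul, eval_X] at this
    linarith
  have := eval_le_eval_of_derivative_nonpos (Q := q - C (B / 2) * (X - C a) ^ 2) hab fun y hy => by
    have := h1 y ⟨hy.1.le, hy.2.le⟩
    simp [derivative_pow]
    linarith
  simp at this
  linarith

lemma eval_le_add_of_derivative_right_nonpos {q : ℝ[X]} {a b t B : ℝ} (hB : 0 ≤ B)
    (ht : t ∈ Set.Icc a b) (hb : (derivative q).eval b ≤ 0)
    (h : ∀ x ∈ Set.Icc a b, -B ≤ (derivative (derivative q)).eval x) :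
    q.eval t ≤ q.eval a + B / 2 * (b - a) ^ 2 := by
  have h1 : ∀ x ∈ Set.Icc a b, (derivative q).eval x ≤ B * (b - x) := by
    intro x hx
    have := eval_le_eval_of_derivative_nonpos (Q := -derivative q - C B * X) hx.2 fun y hy => by
      have := h y ⟨hx.1.trans hy.1.le, hy.2.le⟩
      simp
      linarith
    simp only [eval_sub, eval_C_mul, eval_X, eval_neg] at this
    linarith
  have := eval_le_eval_of_derivative_nonpos (Q := q + C (B / 2) * (X - C b) ^ 2) ht.1
    fun y hy => by
      have := h1 y ⟨hy.1.le, hy.2.le.trans ht.2⟩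
      simp [derivative_pow]
      linarith
  simp at this
  have h2 : 0 ≤ B / 2 * (t - b) ^ 2 := by positivity
  linarith

lemma eval_le_add_of_derivative_nonpos {q : ℝ[X]} {a t B : ℝ} (hB : 0 ≤ B)
    (ht : t ∈ Set.Icc a (a + 1)) (ha : (derivative q).eval a ≤ 0)
    (hb : (derivative q).eval (a + 1) ≤ 0)
    (h : ∀ x ∈ Set.Icc a (a + 1), |(derivative (derivative q)).eval x| ≤ B) :
    q.eval t ≤ q.eval a + B / 4 := by
  rcases le_total t (a + 1 / 2) with hta | hta
  · have h1 := eval_le_add_of_derivative_left_nonpos ht.1 ha fun x hx =>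
      (abs_le.1 (h x ⟨hx.1, hx.2.trans ht.2⟩)).2
    have h2 : (t - a) ^ 2 ≤ 1 / 2 := by nlinarith [ht.1]
    nlinarith
  · have h1 := eval_le_add_of_derivative_left_nonpos (b := a + 1 / 2) (by linarith) ha fun x hx =>
      (abs_le.1 (h x ⟨hx.1, by linarith [hx.2]⟩)).2
    have h2 := eval_le_add_of_derivative_right_nonpos hB ⟨hta, ht.2⟩ hb fun x hx =>
      (abs_le.1 (h x ⟨by linarith [hx.1], hx.2⟩)).1
    linarith

/-- If `q' ≤ 0` at the integers `1, …, k`, then on `[0, k]` the polynomial `q` can only rise on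
those intervals `(j, j + 1)` where `q'` takes a positive value. -/
lemma eval_le_of_derivative_nonpos_at_nat {q : ℝ[X]} {k : ℕ} {B : ℝ} (hB : 0 ≤ B)
    (hq' : ∀ j : ℕ, 1 ≤ j → j ≤ k → (derivative q).eval (j : ℝ) ≤ 0)
    (h : ∀ x ∈ Set.Icc (0 : ℝ) k, |(derivative (derivative q)).eval x| ≤ B)
    (T : ℕ → Prop) [DecidablePred T]
    (hT : ∀ j, ¬ T j → ∀ x ∈ Set.Ioo (j : ℝ) (j + 1), (derivative q).eval x ≤ 0)
    {j : ℕ} (hj : 1 ≤ j) (hjk : j ≤ k) {t : ℝ} (ht : t ∈ Set.Icc (0 : ℝ) j) :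
    q.eval t ≤ q.eval 0 + B / 2 + ((Finset.Ico 1 j).filter T).card * (B / 4) := by
  induction j, hj using Nat.le_induction generalizing t with
  | base =>
    have := eval_le_add_of_derivative_right_nonpos hB ht (hq' 1 le_rfl hjk) fun x hx =>
      (abs_le.1 (h x ⟨hx.1, hx.2.trans (by exact_mod_cast hjk)⟩)).1
    simpa using this
  | succ j hj ih =>
    have hjk' : ((j : ℝ) + 1) ≤ k := by exact_mod_cast hjk
    have ih' := @ih (by omega)
    rw [← Finset.insert_Ico_right_eq_Ico_add_one hj, Finset.filter_insert]
    push_cast at ht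
    rcases le_total t j with htj | htj
    · refine (ih' ⟨ht.1, htj⟩).trans ?_
      split_ifs
      · rw [Finset.card_insert_of_notMem (by simp)]
        push_cast
        linarith
      · exact le_rfl
    · have hj0 := ih' (t := j) ⟨by positivity, le_rfl⟩
      split_ifs with hTj
      · rw [Finset.card_insert_of_notMem (by simp)]
        have := eval_le_add_of_derivative_nonpos hB ⟨htj, ht.2⟩ (hq' j hj (by omega))
          (by exact_mod_cast hq' (j + 1) (by omega) hjk) fun x hx =>
            h x ⟨(Nat.cast_nonneg j).trans hx.1, hx.2.trans hjk'⟩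
        push_cast
        linarith
      · have := eval_le_eval_of_derivative_nonpos htj fun x hx =>
          hT j hTj x ⟨hx.1, hx.2.trans_le ht.2⟩
        linarith

/-- If `r ≤ 0` at `1, …, k` then every interval `(j, j + 1)` on which `r` takes values above `ε > 0`
contains two points where `r = ε`, the interval `(0, 1)` at least one. -/
lemma exists_finset_eval_eq {r : ℝ[X]} {k : ℕ} {ε : ℝ} (hε : 0 < ε)
    (hr : ∀ j : ℕ, 1 ≤ j → j ≤ k → r.eval (j : ℝ) ≤ 0)
    (h0 : ∃ u ∈ Set.Ioo (0 : ℝ) 1, ε < r.eval u) (T : ℕ → Prop) [DecidablePred T]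
    {j : ℕ} (hj : 1 ≤ j) (hjk : j ≤ k)
    (hT : ∀ i ∈ (Finset.Ico 1 j).filter T, ∃ u ∈ Set.Ioo (i : ℝ) (i + 1), ε < r.eval u) :
    ∃ R : Finset ℝ, (∀ x ∈ R, x < j ∧ r.eval x = ε) ∧
      R.card = 1 + 2 * ((Finset.Ico 1 j).filter T).card := by
  induction j, hj using Nat.le_induction with
  | base =>
    obtain ⟨u, hu, hεu⟩ := h0
    have h1 := hr 1 le_rfl hjk
    obtain ⟨a, ha, hra⟩ := intermediate_value_Ioo' hu.2.le r.continuousOn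
      (show ε ∈ Set.Ioo (r.eval 1) (r.eval u) from ⟨by rw [Nat.cast_one] at h1; linarith, hεu⟩)
    exact ⟨{a}, by simpa using ⟨ha.2, hra⟩, by simp⟩
  | succ j hj ih =>
    rw [← Finset.insert_Ico_right_eq_Ico_add_one hj, Finset.filter_insert] at hT ⊢
    obtain ⟨R, hR, hcard⟩ := ih (by omega) fun i hi => hT i (by split_ifs <;> simp_all)
    split_ifs at hT ⊢ with hTj
    · obtain ⟨u, hu, hεu⟩ := hT j (by simp)
      have h1 := hr j hj (by omega)
      have h2 := hr (j + 1) (by omega) hjk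
      push_cast at h2 ⊢
      obtain ⟨a, ha, hra⟩ := intermediate_value_Ioo hu.1.le r.continuousOn
        (show ε ∈ Set.Ioo (r.eval (j : ℝ)) (r.eval u) from ⟨by linarith, hεu⟩)
      obtain ⟨b, hb, hrb⟩ := intermediate_value_Ioo' hu.2.le r.continuousOn
        (show ε ∈ Set.Ioo (r.eval ((j : ℝ) + 1)) (r.eval u) from ⟨by linarith, hεu⟩)
      have haR : a ∉ R := fun h => (hR a h).1.not_gt ha.1
      have hbR : b ∉ insert a R := by
        rw [Finset.mem_insert, not_or]
        exact ⟨(ha.2.trans hb.1).ne', fun h => (hR b h).1.not_gt (hu.1.trans hb.1)⟩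
      refine ⟨insert b (insert a R), ?_, ?_⟩
      · simp only [Finset.mem_insert]
        rintro x (rfl | rfl | hx)
        · exact ⟨hb.2, hrb⟩
        · exact ⟨ha.2.trans hu.2, hra⟩
        · exact ⟨(hR x hx).1.trans (lt_add_one _), (hR x hx).2⟩
      · rw [Finset.card_insert_of_notMem hbR, Finset.card_insert_of_notMem haR,
          Finset.card_insert_of_notMem (by simp), hcard]
        ring
    · refine ⟨R, fun x hx => ⟨(hR x hx).1.trans ?_, (hR x hx).2⟩, hcard⟩
      push_cast
      exact lt_add_one _

lemma one_add_two_mul_card_le_natDegree {r : ℝ[X]} {k : ℕ} (hk : 1 ≤ k)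
    (hr : ∀ j : ℕ, 1 ≤ j → j ≤ k → r.eval (j : ℝ) ≤ 0)
    (h0 : ∃ u ∈ Set.Ioo (0 : ℝ) 1, 0 < r.eval u) (T : ℕ → Prop) [DecidablePred T]
    (hT : ∀ i, T i → ∃ u ∈ Set.Ioo (i : ℝ) (i + 1), 0 < r.eval u) :
    1 + 2 * ((Finset.Ico 1 k).filter T).card ≤ r.natDegree := by
  have hev : ∀ s : Set ℝ, (∃ u ∈ s, 0 < r.eval u) →
      ∀ᶠ ε in nhdsWithin (0 : ℝ) (Set.Ioi 0), ∃ u ∈ s, ε < r.eval u := by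
    rintro s ⟨u, hu, hpos⟩
    filter_upwards [Ioo_mem_nhdsGT hpos] with ε hε using ⟨u, hu, hε.2⟩
  obtain ⟨ε, hεpos, hε0, hεT⟩ := ((eventually_mem_nhdsWithin (a := (0 : ℝ)) (s := Set.Ioi 0)).and
    ((hev _ h0).and ((Filter.eventually_all_finset ((Finset.Ico 1 k).filter T)).2 fun i hi =>
      hev _ (hT i (Finset.mem_filter.1 hi).2)))).exists
  obtain ⟨R, hR, hcard⟩ := exists_finset_eval_eq hεpos hr hε0 T hk le_rfl hεT
  have hne : r - C ε ≠ 0 := fun h => by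
    have h1 := hr 1 le_rfl hk
    rw [sub_eq_zero.1 h, eval_C] at h1
    exact h1.not_gt hεpos
  rw [← hcard, ← natDegree_sub_C (a := ε)]
  refine card_le_degree_of_subset_roots fun x hx => ?_
  rw [mem_roots hne, IsRoot.def, eval_sub, eval_C, (hR x hx).2, sub_self]

theorem stmt9 (k p : ℕ) (hp : 1 ≤ p) (hk : 1 ≤ k)
    (hkp : (k : ℝ) > Real.sqrt ((p : ℝ) ^ 2 * ((p : ℝ) ^ 2 - 1) / 6 * ((p + 2) / 2 : ℕ))) :
    ¬ ∃ q : Polynomial ℝ, q ≠ 0 ∧ q.natDegree = p ∧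
      q.eval 0 = 0 ∧
      (∀ j : ℕ, 1 ≤ j → j ≤ k → 0 ≤ q.eval (j : ℝ)) ∧
      (∀ j : ℕ, 1 ≤ j → j ≤ k → q.derivative.eval (j : ℝ) ≤ 0) ∧
      (∀ x ∈ Set.Icc (0 : ℝ) (k : ℝ), 0 ≤ q.eval x) := by
  rintro ⟨q, hq, hdeg, hq0, -, hq', hnonneg⟩
  have hk1 : (1 : ℝ) ≤ k := by exact_mod_cast hk
  have hk0 : (0 : ℝ) < k := by linarith
  obtain ⟨y, hy, hqy⟩ : ∃ y ∈ Set.Icc (0 : ℝ) 1, 0 < q.eval y := by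
    by_contra! h
    refine hq (eq_zero_of_infinite_isRoot q ((Set.Icc_infinite (zero_lt_one' ℝ)).mono ?_))
    exact fun x hx => (h x hx).antisymm (hnonneg x ⟨hx.1, hx.2.trans hk1⟩)
  obtain ⟨m, hm, hmax⟩ := isCompact_Icc.exists_isMaxOn (Set.nonempty_Icc.2 hk0.le)
    (q.continuousOn (s := Set.Icc (0 : ℝ) k))
  have hM : 0 < q.eval m := hqy.trans_le (hmax ⟨hy.1, hy.2.trans hk1⟩)
  have h0 : ∃ u ∈ Set.Ioo (0 : ℝ) 1, 0 < (derivative q).eval u := by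
    by_contra! h
    have := eval_le_eval_of_derivative_nonpos hy.1 fun x hx => h x ⟨hx.1, hx.2.trans_le hy.2⟩
    linarith
  have hB := fun x (hx : x ∈ Set.Icc (0 : ℝ) k) =>
    abs_eval_derivative_derivative_le_of_mem_Icc hp hdeg.le hk0 hM
      (fun x hx => ⟨hnonneg x hx, hmax hx⟩) hx
  classical
  set T : ℕ → Prop := fun i => ∃ u ∈ Set.Ioo (i : ℝ) (i + 1), 0 < (derivative q).eval u
  have hcard := one_add_two_mul_card_le_natDegree hk hq' h0 T fun i hi => hi
  have hle := eval_le_of_derivative_nonpos_at_nat ((abs_nonneg _).trans (hB m hm)) hq' hB T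
    (fun j hj x hx => not_lt.1 fun hlt => hj ⟨x, hx, hlt⟩) hk le_rfl hm
  have hB0 := (abs_nonneg _).trans (hB m hm)
  have hcard' : (((Finset.Ico 1 k).filter T).card : ℝ) + 2 ≤ ((p + 2) / 2 : ℕ) := by
    have := natDegree_derivative_le q
    exact_mod_cast (by omega : ((Finset.Ico 1 k).filter T).card + 2 ≤ (p + 2) / 2)
  have hk2 := (Real.sqrt_lt' hk0).1 hkp
  generalize (((p + 2) / 2 : ℕ) : ℝ) = N at *
  have h1 : q.eval m ≤ N * (2 * q.eval m / k ^ 2 * ((p : ℝ) ^ 2 * (p ^ 2 - 1) / 3) / 4) := by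
    have := mul_le_mul_of_nonneg_right hcard' (div_nonneg hB0 zero_le_four)
    linarith
  rw [show N * (2 * q.eval m / k ^ 2 * ((p : ℝ) ^ 2 * (p ^ 2 - 1) / 3) / 4) =
    q.eval m * ((p : ℝ) ^ 2 * (p ^ 2 - 1) / 6 * N / k ^ 2) by ring] at h1
  have h2 : (p : ℝ) ^ 2 * (p ^ 2 - 1) / 6 * N / k ^ 2 < 1 := (div_lt_one (by positivity)).2 hk2
  exact h1.not_gt (mul_lt_of_lt_one_right hM h2)
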